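/- Let G be a signed graph with exceptional pairs of odd cycles Pi_1,...,Pi_q (pairs of disjoint odd cycles in a common component with no alternating path between them). Then the normalization of the edge ring k[G] is generated as a k[G]-algebra by the monomials M_{Pi_1},...,M_{Pi_q}, where for Pi = {C, C'}, M_Pi = prod_{v in C} x_v^{sig_C(v)} · prod_{v in C'} x_v^{sig_{C'}(v)}. -/

import Mathlib

open Finset

/-- A signed graph: an undirected graph (possibly with loops) together with a
sign attached to each edge. -/
structure SignedGraph (V : Type) where
  edges : Finset (Sym2 V)
  sgn : Sym2 V → ℤ

namespace SignedGraph

variable {V : Type} [DecidableEq V]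

/-- The sign function takes only the values `1` and `-1` on edges. -/
def Proper (G : SignedGraph V) : Prop :=
  ∀ e ∈ G.edges, G.sgn e = 1 ∨ G.sgn e = -1

/-- `e_i + e_j` for the edge `ij` (a loop `ii` gives `2 e_i`). -/
def endSum : Sym2 V → (V → ℤ) :=
  Sym2.lift ⟨fun i j => Pi.single i 1 + Pi.single j 1, fun i j => add_comm _ _⟩

/-- `ρ(±ij) = sgn(ij)(e_i + e_j)`. -/
def rho (G : SignedGraph V) (e : Sym2 V) : V → ℤ := G.sgn e • endSum e

/-- A walk of length `len` in `G`, recorded by its vertex sequence. -/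
structure Walk (G : SignedGraph V) (len : ℕ) where
  vert : ℕ → V
  mem : ∀ i < len, s(vert i, vert (i + 1)) ∈ G.edges

namespace Walk

variable {G : SignedGraph V} {l l₁ l₂ : ℕ}

/-- The `i`-th edge of a walk. -/
def edge (W : G.Walk l) (i : ℕ) : Sym2 V := s(W.vert i, W.vert (i + 1))

def IsClosed (W : G.Walk l) : Prop := W.vert l = W.vert 0

/-- A cycle: a closed walk of positive length with pairwise distinct vertices
(length 2 is excluded since it would repeat an edge). -/
def IsCycle (W : G.Walk l) : Prop :=
  W.IsClosed ∧ 0 < l ∧ l ≠ 2 ∧ ∀ i < l, ∀ j < l, W.vert i = W.vert j → i = j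

/-- A path: a walk with pairwise distinct vertices. -/
def IsPath (W : G.Walk l) : Prop :=
  ∀ i ≤ l, ∀ j ≤ l, W.vert i = W.vert j → i = j

/-- The signs of consecutive edges alternate along the walk. -/
def Alternating (W : G.Walk l) : Prop :=
  ∀ i, i + 1 < l → G.sgn (W.edge (i + 1)) = -G.sgn (W.edge i)

/-- The signature of the vertex at position `i` of a cycle: the average of the
signs of the two incident edges of the cycle. -/
def sig (W : G.Walk l) (i : ℕ) : ℤ :=
  (G.sgn (W.edge ((i + l - 1) % l)) + G.sgn (W.edge (i % l))) / 2

/-- The exponent vector `∑_{v ∈ C} sig_C(v)·e_v` of the monomial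
`∏_{v ∈ C} x_v^{sig_C(v)}` attached to a cycle. -/
def cycVec (W : G.Walk l) : V → ℤ :=
  fun v => ∑ i ∈ Finset.range l, if W.vert i = v then W.sig i else 0

def edgeFinset (W : G.Walk l) : Finset (Sym2 V) := (Finset.range l).image W.edge

def edgeMS (W : G.Walk l) : Multiset (Sym2 V) := ((List.range l).map W.edge : Multiset (Sym2 V))

def HasVert (W : G.Walk l) (v : V) : Prop := ∃ i < l, W.vert i = v

/-- A reducing closed walk: a closed walk of even length such that whenever an
edge appears at two positions, the number of edges strictly between the two
occurrences is odd. -/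
def ReducingClosedWalk (W : G.Walk l) : Prop :=
  W.IsClosed ∧ Even l ∧
    ∀ i j, i < j → j < l → W.edge i = W.edge j → Odd (j - i - 1)

end Walk

/-- Two vertices lie in the same component iff some walk joins them. -/
def SameComponent (G : SignedGraph V) (u v : V) : Prop :=
  ∃ (n : ℕ) (W : G.Walk n), W.vert 0 = u ∧ W.vert n = v

/-- Two cycles are (vertex-)disjoint. -/
def DisjointCycles {G : SignedGraph V} {l₁ l₂ : ℕ} (C : G.Walk l₁) (C' : G.Walk l₂) : Prop :=
  ∀ i < l₁, ∀ j < l₂, C.vert i ≠ C'.vert j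

/-- There is a sign-alternating path from a vertex of `C` to a vertex of `C'`. -/
def AltPathBetween (G : SignedGraph V) {l₁ l₂ : ℕ} (C : G.Walk l₁) (C' : G.Walk l₂) : Prop :=
  ∃ (p : ℕ) (P : G.Walk p), P.IsPath ∧ P.Alternating ∧
    (∃ i < l₁, P.vert 0 = C.vert i) ∧ (∃ j < l₂, P.vert p = C'.vert j)

/-- The odd cycle condition for signed graphs. -/
def OddCycleCondition (G : SignedGraph V) : Prop :=
  ∀ (l₁ l₂ : ℕ) (C : G.Walk l₁) (C' : G.Walk l₂),
    C.IsCycle → C'.IsCycle → Odd l₁ → Odd l₂ → DisjointCycles C C' →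
    G.SameComponent (C.vert 0) (C'.vert 0) → AltPathBetween G C C'

end SignedGraph

/-- The monomial `x^z` in the Laurent polynomial ring
`k[x_v^{±1} : v ∈ V] = k[(V → ℤ)]`. -/
noncomputable def mono (k : Type) [Field k] {V : Type} (z : V → ℤ) :
    AddMonoidAlgebra k (V → ℤ) :=
  AddMonoidAlgebra.single z 1

/-- The edge ring `k[G]` of a signed graph, generated by the monomials
`(x_i x_j)^{sgn(ij)}` over the edges of `G`. -/
noncomputable def edgeRing (k : Type) [Field k] {V : Type} [DecidableEq V] (G : SignedGraph V) :
    Subalgebra k (AddMonoidAlgebra k (V → ℤ)) :=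
  Algebra.adjoin k ((fun e => mono k (G.rho e)) '' ↑G.edges)

namespace SignedGraph

variable {V : Type} [DecidableEq V]

theorem endSum_mk (i j v : V) :
    endSum s(i, j) v = (if i = v then 1 else 0) + (if j = v then 1 else 0) := by
  simp [endSum, Pi.single_apply, eq_comm]

theorem endSum_nonneg (e : Sym2 V) (v : V) : 0 ≤ endSum e v := by
  induction e with
  | _ i j => rw [endSum_mk]; split_ifs <;> norm_num

theorem endSum_ne_zero_iff {e : Sym2 V} {v : V} : endSum e v ≠ 0 ↔ v ∈ e := by
  induction e with
  | _ i j => rw [endSum_mk, Sym2.mem_iff]; split_ifs <;> grind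

theorem sum_endSum_eq_two {e : Sym2 V} {S : Finset V} (h : ∀ v ∈ e, v ∈ S) :
    ∑ v ∈ S, endSum e v = 2 := by
  induction e with
  | _ i j =>
    have hi := h i (by simp)
    have hj := h j (by simp)
    simp [endSum_mk, Finset.sum_add_distrib, hi, hj]

theorem rho_apply (G : SignedGraph V) (e : Sym2 V) (v : V) :
    G.rho e v = G.sgn e * endSum e v := by
  simp [rho]

namespace Walk

variable {G : SignedGraph V} {l : ℕ}

theorem endSum_edge (W : G.Walk l) (i : ℕ) (v : V) :
    endSum (W.edge i) v
      = (if W.vert i = v then 1 else 0) + (if W.vert (i + 1) = v then 1 else 0) :=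
  endSum_mk _ _ _

theorem edge_mem (W : G.Walk l) {i : ℕ} (hi : i < l) : W.edge i ∈ G.edges := W.mem i hi

theorem sum_mul_endSum_edge {R : Type*} [CommRing R] {W : G.Walk l} (hW : W.IsClosed)
    (hl : 0 < l) (f : ℕ → R) (v : V) :
    ∑ i ∈ range l, f i * (endSum (W.edge i) v : R)
      = ∑ i ∈ range l, if W.vert i = v then f i + f ((i + l - 1) % l) else 0 := by
  obtain ⟨m, rfl⟩ : ∃ m, l = m + 1 := ⟨l - 1, by omega⟩
  have h1 : ∑ i ∈ range (m + 1), f i * (if W.vert (i + 1) = v then 1 else 0)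
      = ∑ i ∈ range (m + 1), if W.vert i = v then f ((i + (m + 1) - 1) % (m + 1)) else 0 := by
    rw [sum_range_succ, sum_range_succ']
    congr 1
    · refine sum_congr rfl fun i hi => ?_
      rw [mem_range] at hi
      have : (i + 1 + (m + 1) - 1) % (m + 1) = i := by
        rw [show i + 1 + (m + 1) - 1 = i + (m + 1) by omega, Nat.add_mod_right,
          Nat.mod_eq_of_lt (by omega)]
      rw [this, mul_ite, mul_one, mul_zero]
    · have : (0 + (m + 1) - 1) % (m + 1) = m := by
        rw [show 0 + (m + 1) - 1 = m by omega, Nat.mod_eq_of_lt (by omega)]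
      rw [this, hW]
      simp
  have h2 : ∀ i, (if W.vert i = v then f i + f ((i + (m + 1) - 1) % (m + 1)) else 0)
      = f i * (if W.vert i = v then 1 else 0)
        + if W.vert i = v then f ((i + (m + 1) - 1) % (m + 1)) else 0 := by
    intro i; split_ifs <;> simp
  simp_rw [h2, sum_add_distrib, ← h1, ← sum_add_distrib, ← mul_add, endSum_edge]
  push_cast
  rfl

theorem IsCycle.sum_mul_endSum_edge_vert {R : Type*} [CommRing R] {W : G.Walk l}
    (hW : W.IsCycle) (f : ℕ → R) {k : ℕ} (hk : k < l) :
    ∑ i ∈ range l, f i * (endSum (W.edge i) (W.vert k) : R) = f k + f ((k + l - 1) % l) := by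
  rw [sum_mul_endSum_edge hW.1 hW.2.1, sum_eq_single k]
  · simp
  · intro i hi hik
    rw [if_neg]
    exact fun h => hik (hW.2.2.2 i (mem_range.1 hi) k hk h)
  · simp [hk]

theorem two_mul_cycVec (hG : G.Proper) {W : G.Walk l} (hW : W.IsCycle) (v : V) :
    2 * W.cycVec v = ∑ i ∈ range l, G.rho (W.edge i) v := by
  have := sum_mul_endSum_edge hW.1 hW.2.1 (fun i => G.sgn (W.edge i)) v
  simp only [Int.cast_id] at this
  simp_rw [rho_apply, this, cycVec, mul_sum]
  refine sum_congr rfl fun i hi => ?_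
  split_ifs
  · have hi := mem_range.1 hi
    rw [sig, Nat.mod_eq_of_lt hi]
    have h1 := hG _ (W.edge_mem hi)
    have h2 := hG _ (W.edge_mem (Nat.mod_lt (i + l - 1) hW.2.1))
    omega
  · simp

/-- Alternating signs around an odd cycle, starting at position `k`. -/
theorem IsCycle.exists_sign_sum_eq_single {W : G.Walk l} (hW : W.IsCycle) (hodd : Odd l) {k : ℕ}
    (hk : k < l) : ∃ ε : ℕ → ℤ, (∀ i, ε i = 1 ∨ ε i = -1) ∧
      ∀ v, ∑ i ∈ range l, ε i * endSum (W.edge i) v = 2 * (Pi.single (W.vert k) 1 : V → ℤ) v := by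
  refine ⟨fun i => if i < k then -(-1) ^ (i + k) else (-1) ^ (i + k), fun i => ?_, fun v => ?_⟩
  · rcases neg_one_pow_eq_or ℤ (i + k) with h | h <;> simp only [h] <;> split_ifs <;> simp
  · have := sum_mul_endSum_edge hW.1 hW.2.1
      (fun i => if i < k then -(-1 : ℤ) ^ (i + k) else (-1) ^ (i + k)) v
    simp only [Int.cast_id] at this
    rw [this, sum_eq_single k]
    · have hkk : (-1 : ℤ) ^ (k + k) = 1 := Even.neg_one_pow ⟨k, rfl⟩
      by_cases hv : W.vert k = v
      · subst hv
        simp only [if_true, lt_irrefl, if_false, Pi.single_eq_same, hkk]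
        rcases Nat.eq_zero_or_pos k with rfl | h0
        · have : (0 + l - 1) % l = l - 1 := by
            rw [Nat.zero_add, Nat.mod_eq_of_lt (by omega)]
          obtain ⟨m, rfl⟩ := hodd
          rw [this]
          simp
        · have h : (k + l - 1) % l = k - 1 := by
            rw [show k + l - 1 = (k - 1) + l by omega, Nat.add_mod_right,
              Nat.mod_eq_of_lt (by omega)]
          obtain ⟨m, rfl⟩ : ∃ m, k = m + 1 := ⟨k - 1, by omega⟩
          rw [h, if_pos (by omega), Odd.neg_one_pow ⟨m, by omega⟩]
          norm_num
      · simp [hv, Ne.symm hv]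
    · intro i hi hik
      have hi := mem_range.1 hi
      split_ifs with h0 h1 h2 h2
      · rcases Nat.eq_zero_or_pos i with rfl | hpos
        · rw [Nat.zero_add, Nat.mod_eq_of_lt (by omega)] at h2
          omega
        · rw [show i + l - 1 = (i - 1) + l by omega, Nat.add_mod_right,
              Nat.mod_eq_of_lt (by omega)]
          obtain ⟨m, rfl⟩ : ∃ m, i = m + 1 := ⟨i - 1, by omega⟩
          rw [show m + 1 + k = (m + k) + 1 by omega, pow_succ]
          simp
      · rcases Nat.eq_zero_or_pos i with rfl | hpos
        · rw [Nat.zero_add, Nat.mod_eq_of_lt (by omega)]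
          obtain ⟨m, rfl⟩ := hodd
          simp [pow_add]
        · rw [show i + l - 1 = (i - 1) + l by omega, Nat.add_mod_right,
              Nat.mod_eq_of_lt (by omega)] at h2
          omega
      · rcases Nat.eq_zero_or_pos i with rfl | hpos
        · omega
        · rw [show i + l - 1 = (i - 1) + l by omega, Nat.add_mod_right,
              Nat.mod_eq_of_lt (by omega)] at h2
          omega
      · rcases Nat.eq_zero_or_pos i with rfl | hpos
        · omega
        · rw [show i + l - 1 = (i - 1) + l by omega, Nat.add_mod_right,
              Nat.mod_eq_of_lt (by omega)]
          obtain ⟨m, rfl⟩ : ∃ m, i = m + 1 := ⟨i - 1, by omega⟩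
          rw [show m + 1 + k = (m + k) + 1 by omega, pow_succ]
          simp
      · rfl
    · simp [hk]

theorem IsCycle.edge_injOn {W : G.Walk l} (hW : W.IsCycle) {i j : ℕ} (hi : i < l) (hj : j < l)
    (h : W.edge i = W.edge j) : i = j := by
  obtain ⟨hc, h0, h2, hinj⟩ := hW
  rw [edge, edge, Sym2.eq_iff] at h
  rcases h with ⟨h, -⟩ | ⟨h, h'⟩
  · exact hinj i hi j hj h
  · have key : ∀ a < l, ∀ b < l, W.vert a = W.vert (b + 1) → a = b + 1 ∨ a = 0 ∧ b + 1 = l := by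
      intro a ha b hb hab
      by_cases hbl : b + 1 = l
      · rw [hbl, hc] at hab
        exact Or.inr ⟨hinj a ha 0 h0 hab, hbl⟩
      · exact Or.inl (hinj a ha (b + 1) (by omega) hab)
    have := key i hi j hj h
    have := key j hj i hi h'.symm
    omega

theorem IsCycle.sum_edgeFinset {M : Type*} [AddCommMonoid M] {W : G.Walk l} (hW : W.IsCycle)
    (f : Sym2 V → M) : ∑ e ∈ W.edgeFinset, f e = ∑ i ∈ range l, f (W.edge i) :=
  sum_image fun _ hi _ hj h => hW.edge_injOn (mem_range.1 hi) (mem_range.1 hj) h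

theorem edgeFinset_subset (W : G.Walk l) : W.edgeFinset ⊆ G.edges := by
  intro e he
  obtain ⟨i, hi, rfl⟩ := mem_image.1 he
  exact W.edge_mem (mem_range.1 hi)

theorem sum_rho_edge_of_alternating {p : ℕ} (P : G.Walk (p + 1)) (hP : P.Alternating) :
    ∑ i ∈ range (p + 1), G.rho (P.edge i)
      = G.sgn (P.edge 0) • (Pi.single (P.vert 0) 1 : V → ℤ)
        + G.sgn (P.edge p) • (Pi.single (P.vert (p + 1)) 1 : V → ℤ) := by
  have key : ∀ m ≤ p, ∑ i ∈ range (m + 1), G.rho (P.edge i)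
      = G.sgn (P.edge 0) • (Pi.single (P.vert 0) 1 : V → ℤ)
        + G.sgn (P.edge m) • (Pi.single (P.vert (m + 1)) 1 : V → ℤ) := by
    intro m hm
    have hr : ∀ i, G.rho (P.edge i) = G.sgn (P.edge i) •
        ((Pi.single (P.vert i) 1 : V → ℤ) + (Pi.single (P.vert (i + 1)) 1 : V → ℤ)) :=
      fun i => rfl
    induction m with
    | zero => simp [hr, smul_add]
    | succ m ih =>
      rw [sum_range_succ, ih (by omega), hr, hP m (by omega)]
      module
  exact key p le_rfl

end Walk

/-- The monoid of exponents of the edge ring. -/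
def edgeMonoid (G : SignedGraph V) : AddSubmonoid (V → ℤ) :=
  AddSubmonoid.closure ((fun e => G.rho e) '' ↑G.edges)

/-- The lattice spanned by the edge vectors. -/
def edgeLattice (G : SignedGraph V) : AddSubgroup (V → ℤ) :=
  AddSubgroup.closure ((fun e => G.rho e) '' ↑G.edges)

theorem rho_mem_edgeMonoid {G : SignedGraph V} {e : Sym2 V} (he : e ∈ G.edges) :
    G.rho e ∈ G.edgeMonoid :=
  AddSubmonoid.subset_closure ⟨e, he, rfl⟩

theorem rho_mem_edgeLattice {G : SignedGraph V} {e : Sym2 V} (he : e ∈ G.edges) :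
    G.rho e ∈ G.edgeLattice :=
  AddSubgroup.subset_closure ⟨e, he, rfl⟩

theorem edgeMonoid_le (G : SignedGraph V) : G.edgeMonoid ≤ G.edgeLattice.toAddSubmonoid :=
  AddSubmonoid.closure_le.2 AddSubgroup.subset_closure

theorem Walk.IsCycle.cycVec_add_mem {G : SignedGraph V} (hG : G.Proper) {l : ℕ} {W : G.Walk l}
    (hW : W.IsCycle) (hodd : Odd l) {k : ℕ} (hk : k < l) {t : ℤ} (ht : t = 1 ∨ t = -1) :
    W.cycVec + t • (Pi.single (W.vert k) 1 : V → ℤ) ∈ G.edgeMonoid := by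
  obtain ⟨ε, hε, hsum⟩ := hW.exists_sign_sum_eq_single hodd hk
  have hn : ∀ i, i < l → ∃ n : ℕ, 2 * (n : ℤ) = 1 + t * ε i * G.sgn (W.edge i) := by
    intro i hi
    rcases ht with rfl | rfl <;> rcases hε i with h | h <;>
      rcases hG _ (W.edge_mem hi) with h' | h' <;> rw [h, h'] <;> norm_num
  choose! n hn using hn
  have : W.cycVec + t • (Pi.single (W.vert k) 1 : V → ℤ)
      = ∑ i ∈ range l, n i • G.rho (W.edge i) := by
    ext v
    have h1 := two_mul_cycVec hG hW v
    have h2 := hsum v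
    have h3 : 2 * ∑ i ∈ range l, (n i : ℤ) * G.rho (W.edge i) v
        = ∑ i ∈ range l, G.rho (W.edge i) v
          + t * ∑ i ∈ range l, ε i * endSum (W.edge i) v := by
      rw [mul_sum, mul_sum, ← sum_add_distrib]
      refine sum_congr rfl fun i hi => ?_
      have hi := mem_range.1 hi
      have hs : G.sgn (W.edge i) * G.sgn (W.edge i) = 1 := by
        rcases hG _ (W.edge_mem hi) with h' | h' <;> rw [h'] <;> norm_num
      rw [← mul_assoc, hn i hi, rho_apply]
      linear_combination t * ε i * endSum (W.edge i) v * hs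
    rw [← h1, h2] at h3
    simp only [Pi.add_apply, Pi.smul_apply, smul_eq_mul, Finset.sum_apply, nsmul_eq_mul] at h3 ⊢
    simp only [Pi.mul_apply, Pi.natCast_apply]
    linarith
  rw [this]
  exact sum_mem fun i hi => nsmul_mem (rho_mem_edgeMonoid (W.edge_mem (mem_range.1 hi))) _

/-- Vectors attached to odd cycles. -/
def oddCycleVecs (G : SignedGraph V) : Set (V → ℤ) :=
  {x | ∃ (l : ℕ) (C : G.Walk l), C.IsCycle ∧ Odd l ∧ C.cycVec = x}

/-- Vectors attached to exceptional pairs of odd cycles. -/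
def exceptionalVecs (G : SignedGraph V) : Set (V → ℤ) :=
  {μ : V → ℤ | ∃ (l₁ l₂ : ℕ) (C : G.Walk l₁) (C' : G.Walk l₂),
            C.IsCycle ∧ C'.IsCycle ∧ Odd l₁ ∧ Odd l₂ ∧
            SignedGraph.DisjointCycles C C' ∧
            G.SameComponent (C.vert 0) (C'.vert 0) ∧
            ¬SignedGraph.AltPathBetween G C C' ∧
            μ = C.cycVec + C'.cycVec}

/-- The monoid generated by the edge vectors and the vectors of exceptional pairs. -/
def exceptionalMonoid (G : SignedGraph V) : AddSubmonoid (V → ℤ) :=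
  AddSubmonoid.closure ((fun e => G.rho e) '' ↑G.edges ∪ G.exceptionalVecs)

theorem edgeMonoid_le_exceptionalMonoid (G : SignedGraph V) :
    G.edgeMonoid ≤ G.exceptionalMonoid :=
  AddSubmonoid.closure_mono Set.subset_union_left

theorem cycVec_add_cycVec_mem {G : SignedGraph V} (hG : G.Proper) {l₁ l₂ : ℕ} {C : G.Walk l₁}
    {C' : G.Walk l₂} (hC : C.IsCycle) (hC' : C'.IsCycle) (h₁ : Odd l₁) (h₂ : Odd l₂)
    (hcomp : G.SameComponent (C.vert 0) (C'.vert 0)) :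
    C.cycVec + C'.cycVec ∈ G.exceptionalMonoid := by
  by_cases hd : DisjointCycles C C'
  · by_cases ha : AltPathBetween G C C'
    · apply G.edgeMonoid_le_exceptionalMonoid
      obtain ⟨p, P, -, hP, ⟨i, hi, hPi⟩, ⟨j, hj, hPj⟩⟩ := ha
      obtain _ | p := p
      · exact absurd (hPi.symm.trans hPj) (hd i hi j hj)
      · have hs : ∀ m < p + 1, -G.sgn (P.edge m) = 1 ∨ -G.sgn (P.edge m) = -1 := by
          intro m hm
          have := hG _ (P.edge_mem hm)
          omega
        have e1 := hC.cycVec_add_mem hG h₁ hi (hs 0 (by omega))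
        have e2 := hC'.cycVec_add_mem hG h₂ hj (hs p (by omega))
        have e3 : ∑ m ∈ range (p + 1), G.rho (P.edge m) ∈ G.edgeMonoid :=
          sum_mem fun m hm => rho_mem_edgeMonoid (P.edge_mem (mem_range.1 hm))
        rw [P.sum_rho_edge_of_alternating hP, hPi, hPj] at e3
        convert add_mem (add_mem e1 e2) e3 using 1
        module
    · exact AddSubmonoid.subset_closure
        (Or.inr ⟨l₁, l₂, C, C', hC, hC', h₁, h₂, hd, hcomp, ha, rfl⟩)
  · apply G.edgeMonoid_le_exceptionalMonoid
    simp only [DisjointCycles, not_forall, not_not] at hd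
    obtain ⟨i, hi, j, hj, hij⟩ := hd
    have e1 := hC.cycVec_add_mem hG h₁ hi (Or.inl rfl)
    have e2 := hC'.cycVec_add_mem hG h₂ hj (Or.inr rfl)
    rw [hij] at e1
    convert add_mem e1 e2 using 1
    module

theorem Walk.single_add_or_sub_mem {G : SignedGraph V} (hG : G.Proper) {n : ℕ} (W : G.Walk n) :
    ∃ t : ℤ, (t = 1 ∨ t = -1) ∧ (Pi.single (W.vert n) 1 : V → ℤ)
      + t • (Pi.single (W.vert 0) 1 : V → ℤ) ∈ G.edgeLattice := by
  have key : ∀ m ≤ n, ∃ t : ℤ, (t = 1 ∨ t = -1) ∧ (Pi.single (W.vert m) 1 : V → ℤ)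
      + t • (Pi.single (W.vert 0) 1 : V → ℤ) ∈ G.edgeLattice := by
    intro m hm
    induction m with
    | zero => exact ⟨-1, Or.inr rfl, by simp⟩
    | succ m ih =>
      obtain ⟨t, ht, hmem⟩ := ih (by omega)
      have hr : (Pi.single (W.vert m) 1 : V → ℤ) + (Pi.single (W.vert (m + 1)) 1 : V → ℤ)
          ∈ G.edgeLattice := by
        have h := rho_mem_edgeLattice (W.edge_mem (i := m) (by omega))
        have e : G.rho (W.edge m) = G.sgn (W.edge m) • ((Pi.single (W.vert m) 1 : V → ℤ)
          + (Pi.single (W.vert (m + 1)) 1 : V → ℤ)) := rfl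
        rw [e] at h
        rcases hG _ (W.edge_mem (i := m) (by omega)) with h' | h' <;> rw [h'] at h
        · simpa using h
        · rw [neg_one_smul] at h
          exact neg_mem_iff.1 h
      refine ⟨-t, by omega, ?_⟩
      convert sub_mem hr hmem using 1
      module
  exact key n le_rfl

theorem cycVec_add_cycVec_mem_edgeLattice {G : SignedGraph V} (hG : G.Proper) {l₁ l₂ : ℕ}
    {C : G.Walk l₁} {C' : G.Walk l₂} (hC : C.IsCycle) (hC' : C'.IsCycle) (h₁ : Odd l₁)
    (h₂ : Odd l₂) (hcomp : G.SameComponent (C.vert 0) (C'.vert 0)) :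
    C.cycVec + C'.cycVec ∈ G.edgeLattice := by
  obtain ⟨n, W, hW0, hWn⟩ := hcomp
  obtain ⟨t, ht, hmem⟩ := W.single_add_or_sub_mem hG
  rw [hW0, hWn] at hmem
  have e1 : _ ∈ G.edgeLattice :=
    G.edgeMonoid_le (hC.cycVec_add_mem hG h₁ hC.2.1 (t := -t) (by omega))
  have e2 : _ ∈ G.edgeLattice :=
    G.edgeMonoid_le (hC'.cycVec_add_mem hG h₂ hC'.2.1 (Or.inr rfl))
  convert add_mem (add_mem e1 e2) hmem using 1
  module

theorem SameComponent.step {G : SignedGraph V} {u v w : V} (h : G.SameComponent u v)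
    (he : s(v, w) ∈ G.edges) : G.SameComponent u w := by
  obtain ⟨n, W, hW0, hWn⟩ := h
  refine ⟨n + 1, ⟨fun i => if i ≤ n then W.vert i else w, fun i hi => ?_⟩, ?_, ?_⟩
  · rcases Nat.lt_or_ge i n with h | h
    · simpa [h.le, h] using W.mem i h
    · obtain rfl : i = n := by omega
      simpa [hWn] using he
  · simpa using hW0
  · simp

/-- The finset of all vertices on the edges of a finset. -/
def vertexFinset (F : Finset (Sym2 V)) : Finset V := F.biUnion Sym2.toFinset

theorem mem_vertexFinset {F : Finset (Sym2 V)} {v : V} :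
    v ∈ vertexFinset F ↔ ∃ e ∈ F, v ∈ e := by
  simp [vertexFinset]

open scoped Classical in
/-- The sum of the coordinates lying in the component of `u`. -/
noncomputable def componentSum (G : SignedGraph V) (u : V) : (V → ℤ) →+ ℤ :=
  ∑ v ∈ (vertexFinset G.edges).filter (G.SameComponent u), Pi.evalAddMonoidHom _ v

open scoped Classical in
theorem componentSum_rho {G : SignedGraph V} (u : V) {i j : V} (he : s(i, j) ∈ G.edges) :
    G.componentSum u (G.rho s(i, j)) = if G.SameComponent u i then 2 * G.sgn s(i, j) else 0 := by
  have hij : G.SameComponent u i ↔ G.SameComponent u j :=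
    ⟨fun h => h.step he, fun h => h.step (Sym2.eq_swap ▸ he)⟩
  have hi : i ∈ vertexFinset G.edges := mem_vertexFinset.2 ⟨_, he, by simp⟩
  have hj : j ∈ vertexFinset G.edges := mem_vertexFinset.2 ⟨_, he, by simp⟩
  simp only [componentSum, AddMonoidHom.finsetSum_apply, Pi.evalAddMonoidHom_apply, rho_apply,
    ← mul_sum]
  split_ifs with h
  · rw [sum_endSum_eq_two, mul_comm]
    intro v hv
    rcases Sym2.mem_iff.1 hv with rfl | rfl
    · simp [hi, h]
    · simp [hj, hij.1 h]
  · rw [sum_eq_zero, mul_zero]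
    intro v hv
    by_contra h0
    rcases Sym2.mem_iff.1 (endSum_ne_zero_iff.1 h0) with rfl | rfl
    · exact h (mem_filter.1 hv).2
    · exact h (hij.2 (mem_filter.1 hv).2)

theorem even_componentSum {G : SignedGraph V} (u : V) {z : V → ℤ} (hz : z ∈ G.edgeLattice) :
    Even (G.componentSum u z) := by
  induction hz using AddSubgroup.closure_induction with
  | mem x hx =>
    obtain ⟨e, he, rfl⟩ := hx
    induction e with
    | _ i j =>
      classical
      have := componentSum_rho u he
      simp only at this ⊢
      rw [this]
      split_ifs <;> simp
  | zero => simp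
  | add x y _ _ hx hy => rw [map_add]; exact hx.add hy
  | neg x _ hx => rw [map_neg]; exact hx.neg

theorem Walk.sameComponent_vert_iff {G : SignedGraph V} {l : ℕ} (W : G.Walk l) (u : V) {i : ℕ}
    (hi : i ≤ l) : G.SameComponent u (W.vert i) ↔ G.SameComponent u (W.vert 0) := by
  induction i with
  | zero => rfl
  | succ i ih =>
    rw [← ih (by omega)]
    have he := W.mem i (by omega)
    exact ⟨fun h => h.step (Sym2.eq_swap ▸ he), fun h => h.step he⟩

theorem odd_componentSum_cycVec_iff {G : SignedGraph V} (hG : G.Proper) (u : V) {l : ℕ}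
    {C : G.Walk l} (hC : C.IsCycle) (hodd : Odd l) :
    Odd (G.componentSum u C.cycVec) ↔ G.SameComponent u (C.vert 0) := by
  classical
  have h2 : (2 : ℕ) • C.cycVec = ∑ i ∈ range l, G.rho (C.edge i) := by
    ext v
    rw [Finset.sum_apply, ← Walk.two_mul_cycVec hG hC]
    simp
  have h3 := congrArg (G.componentSum u) h2
  have h4 : ∀ i ∈ range l, G.componentSum u (G.rho (C.edge i))
      = 2 * if G.SameComponent u (C.vert 0) then G.sgn (C.edge i) else 0 := by
    intro i hi
    have hi := mem_range.1 hi
    rw [Walk.edge, componentSum_rho u (C.mem i hi), C.sameComponent_vert_iff u hi.le]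
    split_ifs <;> simp
  rw [map_nsmul, map_sum, sum_congr rfl h4, ← mul_sum, nsmul_eq_mul, Nat.cast_ofNat] at h3
  have h5 := mul_left_cancel₀ two_ne_zero h3
  rw [h5]
  by_cases h : G.SameComponent u (C.vert 0)
  · simp only [h, if_true, iff_true]
    have hdvd : 2 ∣ ∑ i ∈ range l, (G.sgn (C.edge i) - 1) := dvd_sum fun i hi => by
      have := hG _ (C.edge_mem (mem_range.1 hi))
      omega
    rw [sum_sub_distrib, sum_const, card_range, nsmul_eq_mul, mul_one] at hdvd
    obtain ⟨m, rfl⟩ := hodd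
    rw [Int.odd_iff]
    push_cast at hdvd
    omega
  · simp [h]

theorem sum_mem_exceptionalMonoid {G : SignedGraph V} (hG : G.Proper) (n : ℕ)
    (L : List (V → ℤ)) (hn : L.length = n) (hL : ∀ x ∈ L, x ∈ G.oddCycleVecs)
    (hlat : L.sum ∈ G.edgeLattice) : L.sum ∈ G.exceptionalMonoid := by
  induction n using Nat.strong_induction_on generalizing L with
  | _ n ih =>
    obtain _ | ⟨x, L⟩ := L
    · simp
    · obtain ⟨l, C, hC, hodd, rfl⟩ := hL x (by simp)
      have hself : Odd (G.componentSum (C.vert 0) C.cycVec) :=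
        (odd_componentSum_cycVec_iff hG _ hC hodd).2 ⟨0, ⟨C.vert, by simp⟩, rfl, rfl⟩
      have heven := even_componentSum (C.vert 0) hlat
      rw [List.sum_cons, map_add] at heven
      have hodd' : ¬ Even (G.componentSum (C.vert 0) L.sum) := by
        intro h
        exact (Int.not_even_iff_odd.2 hself) ((Int.even_add.1 heven).2 h)
      obtain ⟨y, hy, hyodd⟩ : ∃ y ∈ L, Odd (G.componentSum (C.vert 0) y) := by
        by_contra! hcon
        apply hodd'
        clear hodd' heven hlat hn hL
        induction L with
        | nil => simp
        | cons y L ihL =>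
          rw [List.sum_cons, map_add]
          exact (Int.not_odd_iff_even.1 (hcon y (by simp))).add
            (ihL fun x hx => hcon x (by simp [hx]))
      obtain ⟨l', C', hC', hl', rfl⟩ := hL y (by simp [hy])
      have hcomp := (odd_componentSum_cycVec_iff hG _ hC' hl').1 hyodd
      obtain ⟨s, t, rfl⟩ := List.append_of_mem hy
      have hsum : (C.cycVec :: (s ++ C'.cycVec :: t)).sum
          = (C.cycVec + C'.cycVec) + (s ++ t).sum := by
        simp only [List.sum_cons, List.sum_append]
        abel
      rw [hsum] at hlat ⊢
      refine add_mem (cycVec_add_cycVec_mem hG hC hC' hodd hl' hcomp)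
        (ih (s ++ t).length (by simp at hn ⊢; omega) _ rfl (fun x hx => hL x ?_) ?_)
      · simp only [List.mem_append, List.mem_cons] at hx ⊢
        tauto
      · have := sub_mem hlat (cycVec_add_cycVec_mem_edgeLattice hG hC hC' hodd hl' hcomp)
        rwa [add_sub_cancel_left] at this

/-- A finite set of edges in which every edge can be continued contains a cycle. -/
theorem exists_isCycle_of_forall_exists {G : SignedGraph V} {F : Finset (Sym2 V)}
    (hF : F ⊆ G.edges) (hne : F.Nonempty)
    (hnext : ∀ p v, s(p, v) ∈ F → p ≠ v → ∃ q ≠ p, s(v, q) ∈ F) :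
    ∃ (l : ℕ) (W : G.Walk l), W.IsCycle ∧ ∀ i < l, W.edge i ∈ F := by
  classical
  have hnext' : ∀ d : {d : V × V // s(d.1, d.2) ∈ F}, ∃ d' : {d : V × V // s(d.1, d.2) ∈ F},
      d'.1.1 = d.1.2 ∧ (d'.1.2 ≠ d.1.1 ∨ d.1.1 = d.1.2) := by
    rintro ⟨⟨p, v⟩, hd⟩
    by_cases hpv : p = v
    · exact ⟨⟨(p, v), hd⟩, hpv, Or.inr hpv⟩
    · obtain ⟨q, hq, hm⟩ := hnext p v hd hpv
      exact ⟨⟨(v, q), hm⟩, rfl, Or.inl hq⟩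
  choose nxt hnxt1 hnxt2 using hnext'
  obtain ⟨e, he⟩ := hne
  obtain ⟨⟨x, y⟩, rfl⟩ := e.exists_rep
  let d : ℕ → {d : V × V // s(d.1, d.2) ∈ F} := fun n => nxt^[n] ⟨(x, y), he⟩
  let w : ℕ → V := fun n => (d n).1.1
  have hd : ∀ n, d (n + 1) = nxt (d n) := fun n => Function.iterate_succ_apply' _ _ _
  have hw : ∀ n, w (n + 1) = (d n).1.2 := fun n => by simp only [w, hd, hnxt1]
  have hmem : ∀ n, s(w n, w (n + 1)) ∈ F := fun n => by rw [hw]; exact (d n).2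
  have hback : ∀ n, w (n + 2) ≠ w n ∨ w n = w (n + 1) := fun n => by
    have := hnxt2 (d n)
    rwa [← hd, ← hw, ← hw] at this
  have hex : ∃ m, 0 < m ∧ ∃ i, w (i + m) = w i := by
    obtain ⟨a, b, hab, h⟩ := Set.Finite.exists_lt_map_eq_of_forall_mem (f := w)
      (t := (vertexFinset F : Set V)) (fun n => mem_vertexFinset.2 ⟨_, hmem n, by simp⟩)
      (Finset.finite_toSet _)
    exact ⟨b - a, by omega, a, by rw [h]; congr 1; omega⟩
  obtain ⟨hpos, i, hi⟩ := Nat.find_spec hex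
  have hmin := fun m => Nat.find_min hex (m := m)
  set m := Nat.find hex
  refine ⟨m, ⟨fun k => w (i + k), fun k _ => hF (hmem (i + k))⟩, ⟨hi, hpos, ?_, ?_⟩,
    fun k _ => hmem (i + k)⟩
  · intro hm
    rw [hm] at hi hmin
    rcases hback i with h | h
    · exact h hi
    · exact hmin 1 (by norm_num) ⟨one_pos, i, h.symm⟩
  · have key : ∀ a b, a < b → b < m → w (i + a) ≠ w (i + b) := by
      intro a b hab hb h
      refine hmin (b - a) (by omega) ⟨by omega, i + a, ?_⟩
      rw [h]
      congr 1
      omega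
    intro a ha b hb h
    rcases lt_trichotomy a b with hab | hab | hab
    · exact absurd h (key a b hab hb)
    · exact hab
    · exact absurd h.symm (key b a hab ha)

/-- A linear relation between edge vectors can be used to make a further coefficient an
integer. -/
theorem exists_shift {G : SignedGraph V} {F : Finset (Sym2 V)} (hF : F ⊆ G.edges)
    {a lam : Sym2 V → ℝ} (ha : ∀ e, 0 ≤ a e)
    (hlam : ∀ v, ∑ e ∈ F, lam e * (G.rho e v : ℝ) = 0) (hne : ∃ e ∈ F, lam e ≠ 0) :
    ∃ b : Sym2 V → ℝ, (∀ e, 0 ≤ b e) ∧ (∀ e ∉ F, b e = a e) ∧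
      (∃ e ∈ F, ∃ n : ℤ, (n : ℝ) = b e) ∧
      ∀ v, ∑ e ∈ G.edges, b e * (G.rho e v : ℝ) = ∑ e ∈ G.edges, a e * (G.rho e v : ℝ) := by
  wlog hneg : ∃ e ∈ F, lam e < 0 generalizing lam
  · refine this (lam := fun e => -lam e) (fun v => ?_) ?_ ?_
    · simp only [neg_mul, sum_neg_distrib, hlam, neg_zero]
    · simpa using hne
    · obtain ⟨e, he, h0⟩ := hne
      push Not at hneg
      exact ⟨e, he, neg_neg_of_pos (lt_of_le_of_ne (hneg e he) h0.symm)⟩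
  obtain ⟨e₁, he₁, h₁⟩ := hneg
  obtain ⟨e₀, he₀, hmin⟩ := (F.filter (fun e => lam e < 0)).exists_min_image
    (fun e => Int.fract (a e) / (-lam e)) ⟨e₁, mem_filter.2 ⟨he₁, h₁⟩⟩
  obtain ⟨he₀, h₀⟩ := mem_filter.1 he₀
  set t := Int.fract (a e₀) / (-lam e₀) with ht
  have ht0 : 0 ≤ t := div_nonneg (Int.fract_nonneg _) (by linarith)
  refine ⟨fun e => if e ∈ F then a e + t * lam e else a e, fun e => ?_, fun e he => if_neg he,
    ⟨e₀, he₀, ⌊a e₀⌋, ?_⟩, fun v => ?_⟩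
  · dsimp only
    split_ifs with he
    · rcases lt_or_ge (lam e) 0 with h | h
      · have h1 := hmin e (mem_filter.2 ⟨he, h⟩)
        rw [le_div_iff₀ (by linarith)] at h1
        have h2 : (0 : ℝ) ≤ ⌊a e⌋ := by exact_mod_cast Int.floor_nonneg.2 (ha e)
        have h3 := Int.floor_add_fract (a e)
        linarith
      · exact add_nonneg (ha e) (mul_nonneg ht0 h)
    · exact ha e
  · have h3 := Int.floor_add_fract (a e₀)
    have h4 : t * lam e₀ = -Int.fract (a e₀) := by
      rw [ht, div_neg, neg_mul, div_mul_cancel₀ _ h₀.ne]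
    simp only [he₀, if_true, h4]
    linarith
  · have h1 : ∀ e, (if e ∈ F then a e + t * lam e else a e) * (G.rho e v : ℝ)
        = a e * (G.rho e v : ℝ) + t * if e ∈ F then lam e * (G.rho e v : ℝ) else 0 := by
      intro e; split_ifs <;> ring
    simp_rw [h1, sum_add_distrib, ← mul_sum, sum_ite_mem, inter_eq_right.2 hF, hlam]
    simp

theorem exists_relation_of_card_lt {G : SignedGraph V} {F : Finset (Sym2 V)}
    (h : (vertexFinset F).card < F.card) :
    ∃ lam : Sym2 V → ℝ, (∀ v, ∑ e ∈ F, lam e * (G.rho e v : ℝ) = 0) ∧ ∃ e ∈ F, lam e ≠ 0 := by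
  have hdep : ¬ LinearIndependent ℝ
      (fun (e : F) (v : vertexFinset F) => (G.rho e v : ℝ)) := by
    intro hli
    have := hli.fintype_card_le_finrank
    simp at this
    omega
  rw [Fintype.not_linearIndependent_iff] at hdep
  obtain ⟨g, hg, ⟨e, he⟩, hne⟩ := hdep
  refine ⟨fun e => if h : e ∈ F then g ⟨e, h⟩ else 0, fun v => ?_, e, he, by simpa [he] using hne⟩
  by_cases hv : v ∈ vertexFinset F
  · have := congrFun hg ⟨v, hv⟩
    simp only [Finset.sum_apply, Pi.smul_apply, smul_eq_mul, Pi.zero_apply] at this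
    rw [← this, ← sum_coe_sort F]
    simp
  · refine sum_eq_zero fun e he => ?_
    have : endSum e v = 0 := by
      by_contra h0
      exact hv (mem_vertexFinset.2 ⟨e, he, endSum_ne_zero_iff.1 h0⟩)
    simp [rho_apply, this]

theorem Walk.IsCycle.exists_relation_of_even {G : SignedGraph V} (hG : G.Proper) {l : ℕ}
    {C : G.Walk l} (hC : C.IsCycle) (hl : Even l) :
    ∃ lam : Sym2 V → ℝ, (∀ v, ∑ e ∈ C.edgeFinset, lam e * (G.rho e v : ℝ) = 0) ∧
      ∃ e ∈ C.edgeFinset, lam e ≠ 0 := by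
  have hsq : ∀ i < l, (G.sgn (C.edge i) : ℝ) * G.sgn (C.edge i) = 1 := by
    intro i hi
    rcases hG _ (C.edge_mem hi) with h' | h' <;> rw [h'] <;> norm_num
  let lam : Sym2 V → ℝ := fun e =>
    ∑ i ∈ range l, if C.edge i = e then (-1) ^ i * (G.sgn e : ℝ) else 0
  have hlam : ∀ i < l, lam (C.edge i) = (-1) ^ i * (G.sgn (C.edge i) : ℝ) := by
    intro i hi
    simp only [lam]
    rw [sum_eq_single i]
    · simp
    · intro j hj hji
      rw [if_neg]
      exact fun h => hji (hC.edge_injOn (mem_range.1 hj) hi h)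
    · simp [hi]
  refine ⟨lam, fun v => ?_, C.edge 0, mem_image_of_mem _ (mem_range.2 hC.2.1), ?_⟩
  · rw [hC.sum_edgeFinset]
    have h1 : ∀ i ∈ range l, lam (C.edge i) * (G.rho (C.edge i) v : ℝ)
        = (-1) ^ i * (endSum (C.edge i) v : ℝ) := by
      intro i hi
      have hi := mem_range.1 hi
      rw [hlam i hi, rho_apply]
      push_cast
      linear_combination (-1) ^ i * (endSum (C.edge i) v : ℝ) * hsq i hi
    rw [sum_congr rfl h1, sum_mul_endSum_edge hC.1 hC.2.1]
    refine sum_eq_zero fun i hi => ?_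
    have hi := mem_range.1 hi
    split_ifs
    · rcases Nat.eq_zero_or_pos i with rfl | hpos
      · have := hC.2.1
        rw [Nat.zero_add, Nat.mod_eq_of_lt (by omega)]
        obtain ⟨m, rfl⟩ := hl
        rw [Odd.neg_one_pow (n := m + m - 1) ⟨m - 1, by omega⟩]
        simp
      · rw [show i + l - 1 = (i - 1) + l by omega, Nat.add_mod_right,
          Nat.mod_eq_of_lt (by omega)]
        obtain ⟨m, rfl⟩ : ∃ m, i = m + 1 := ⟨i - 1, by omega⟩
        simp [pow_succ]
    · rfl
  · rw [hlam 0 hC.2.1]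
    intro h
    have := hsq 0 hC.2.1
    simp only [pow_zero, one_mul] at h
    rw [h] at this
    simp at this

/-- If the non-integral coefficients of an integral vector are supported on linearly
independent edges, they contain an odd cycle with half-integral coefficients. -/
theorem exists_odd_cycle {G : SignedGraph V} (hG : G.Proper) {z : V → ℤ} {a : Sym2 V → ℝ}
    (hz : ∀ v, (z v : ℝ) = ∑ e ∈ G.edges, a e * (G.rho e v : ℝ))
    {F : Finset (Sym2 V)} (hF : ∀ e, e ∈ F ↔ e ∈ G.edges ∧ ¬ ∃ n : ℤ, (n : ℝ) = a e)
    (hne : F.Nonempty)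
    (hind : ∀ lam : Sym2 V → ℝ, (∀ v, ∑ e ∈ F, lam e * (G.rho e v : ℝ) = 0) →
      ∀ e ∈ F, lam e = 0) :
    ∃ (l : ℕ) (C : G.Walk l), C.IsCycle ∧ Odd l ∧ C.edgeFinset ⊆ F ∧
      ∀ e ∈ C.edgeFinset, ∃ n : ℤ, (n : ℝ) = 2 * a e := by
  have hFE : F ⊆ G.edges := fun e he => ((hF e).1 he).1
  let Z : AddSubgroup ℝ := (Int.castAddHom ℝ).range
  have hZ : ∀ x : ℝ, x ∈ Z ↔ ∃ n : ℤ, (n : ℝ) = x := fun x => Iff.rfl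
  have hsgnZ : ∀ e ∈ G.edges, ∀ x : ℝ, x * G.sgn e ∈ Z ↔ x ∈ Z := by
    intro e he x
    rcases hG e he with h | h <;> rw [h] <;> simp
  have hintegral : ∀ v, ∑ e ∈ F, a e * (G.rho e v : ℝ) ∈ Z := by
    intro v
    have h1 : ∑ e ∈ G.edges \ F, a e * (G.rho e v : ℝ) ∈ Z := by
      refine sum_mem fun e he => ?_
      obtain ⟨h1, h2⟩ := mem_sdiff.1 he
      obtain ⟨n, hn⟩ : ∃ n : ℤ, (n : ℝ) = a e := by
        by_contra hcon
        exact h2 ((hF e).2 ⟨h1, hcon⟩)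
      exact ⟨n * G.rho e v, by simp [← hn]⟩
    have h2 : (z v : ℝ) ∈ Z := ⟨z v, rfl⟩
    rw [hz v, ← sum_sdiff hFE] at h2
    exact (AddSubgroup.add_mem_cancel_left Z h1).1 h2
  have hcard : F.card ≤ (vertexFinset F).card := by
    by_contra! hlt
    obtain ⟨lam, h1, e, he, h2⟩ := exists_relation_of_card_lt (G := G) hlt
    exact h2 (hind lam h1 e he)
  have hdeg2 : ∀ v ∈ vertexFinset F, 2 ≤ ∑ e ∈ F, endSum e v := by
    intro v hv
    by_contra! hlt
    obtain ⟨e, he, hve⟩ := mem_vertexFinset.1 hv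
    have h1 : 1 ≤ endSum e v := by
      have := endSum_ne_zero_iff.2 hve
      have := endSum_nonneg e v
      omega
    have h2 : ∑ e' ∈ F.erase e, endSum e' v + endSum e v = ∑ e' ∈ F, endSum e' v :=
      sum_erase_add _ _ he
    have h3 : 0 ≤ ∑ e' ∈ F.erase e, endSum e' v := sum_nonneg fun e' _ => endSum_nonneg e' v
    have h4 := (sum_eq_zero_iff_of_nonneg fun e' _ => endSum_nonneg e' v).1
      (show ∑ e' ∈ F.erase e, endSum e' v = 0 by omega)
    have h5 : endSum e v = 1 := by omega
    have h6 := hintegral v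
    rw [sum_eq_single e (fun e' he' hne => by
      rw [rho_apply, h4 e' (mem_erase.2 ⟨hne, he'⟩)]; simp) (fun h => absurd he h),
      rho_apply, h5, mul_one, hsgnZ e (hFE he)] at h6
    exact ((hF e).1 he).2 h6
  have hdeg : ∀ v ∈ vertexFinset F, ∑ e ∈ F, endSum e v = 2 := by
    have h1 : ∑ v ∈ vertexFinset F, ∑ e ∈ F, endSum e v = ∑ e ∈ F, 2 := by
      rw [sum_comm]
      exact sum_congr rfl fun e he =>
        sum_endSum_eq_two fun v hv => mem_vertexFinset.2 ⟨e, he, hv⟩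
    have h2 : ∑ v ∈ vertexFinset F, (2 : ℤ) = ∑ v ∈ vertexFinset F, ∑ e ∈ F, endSum e v := by
      refine le_antisymm (sum_le_sum hdeg2) ?_
      rw [h1]
      simp only [sum_const, nsmul_eq_mul]
      have : (F.card : ℤ) ≤ (vertexFinset F).card := by exact_mod_cast hcard
      linarith
    exact fun v hv => ((sum_eq_sum_iff_of_le hdeg2).1 h2 v hv).symm
  have hnext : ∀ p v, s(p, v) ∈ F → p ≠ v → ∃ q ≠ p, s(v, q) ∈ F := by
    intro p v hpv hne
    have h1 := hdeg v (mem_vertexFinset.2 ⟨_, hpv, by simp⟩)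
    rw [← sum_erase_add _ _ hpv, endSum_mk, if_neg hne, if_pos rfl] at h1
    obtain ⟨e, he, h2⟩ := exists_ne_zero_of_sum_ne_zero
      (show ∑ e ∈ F.erase s(p, v), endSum e v ≠ 0 by omega)
    obtain ⟨q, rfl⟩ := endSum_ne_zero_iff.1 h2
    obtain ⟨h3, h4⟩ := mem_erase.1 he
    exact ⟨q, fun h => h3 (by rw [h, Sym2.eq_swap]), h4⟩
  obtain ⟨l, C, hC, hCF⟩ := exists_isCycle_of_forall_exists hFE hne hnext
  have hsub : C.edgeFinset ⊆ F := by
    intro e he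
    obtain ⟨i, hi, rfl⟩ := mem_image.1 he
    exact hCF i (mem_range.1 hi)
  have hodd : Odd l := by
    by_contra hl
    obtain ⟨lam, h1, e, he, h2⟩ := hC.exists_relation_of_even hG (Nat.not_odd_iff_even.1 hl)
    have h3 := hind (fun e => if e ∈ C.edgeFinset then lam e else 0) (fun v => by
      simp_rw [ite_mul, zero_mul, sum_ite_mem, inter_eq_right.2 hsub, h1 v]) e (hsub he)
    simp only [he, if_true] at h3
    exact h2 h3
  refine ⟨l, C, hC, hodd, hsub, ?_⟩
  let b : ℕ → ℝ := fun i => a (C.edge i) * G.sgn (C.edge i)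
  have hb : ∀ k < l, b k + b ((k + l - 1) % l) ∈ Z := by
    intro k hk
    have hv : C.vert k ∈ vertexFinset F := mem_vertexFinset.2 ⟨_, hCF k hk, by simp [Walk.edge]⟩
    have h1 := hC.sum_mul_endSum_edge_vert (fun _ => (1 : ℤ)) hk
    simp only [one_mul, Int.cast_id] at h1
    rw [← hC.sum_edgeFinset (fun e => endSum e (C.vert k))] at h1
    have h2 := hdeg _ hv
    rw [← sum_sdiff hsub, h1] at h2
    have h3 := (sum_eq_zero_iff_of_nonneg fun e' _ => endSum_nonneg e' (C.vert k)).1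
      (show ∑ e ∈ F \ C.edgeFinset, endSum e (C.vert k) = 0 by omega)
    have h4 := hintegral (C.vert k)
    rw [← sum_sdiff hsub, sum_eq_zero (fun e he => by rw [rho_apply, h3 e he]; simp), zero_add,
      hC.sum_edgeFinset] at h4
    convert h4 using 1
    rw [← hC.sum_mul_endSum_edge_vert b hk]
    refine sum_congr rfl fun i _ => ?_
    simp only [b, rho_apply]
    push_cast
    ring
  have hb' : ∀ k < l, b k - (-1) ^ k * b 0 ∈ Z := by
    intro k
    induction k with
    | zero => intro _; simp
    | succ k ih =>
      intro hk
      have h1 := hb (k + 1) hk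
      rw [show k + 1 + l - 1 = k + l by omega, Nat.add_mod_right,
        Nat.mod_eq_of_lt (by omega)] at h1
      convert sub_mem h1 (ih (by omega)) using 1
      rw [pow_succ]
      ring
  have h20 : 2 * b 0 ∈ Z := by
    have h1 := hb 0 hC.2.1
    have hl0 := hC.2.1
    have h2 := hb' (l - 1) (by omega)
    rw [Nat.zero_add, Nat.mod_eq_of_lt (by omega)] at h1
    rw [Even.neg_one_pow (Nat.Odd.sub_odd hodd odd_one)] at h2
    convert sub_mem h1 h2 using 1
    ring
  intro e he
  obtain ⟨i, hi, rfl⟩ := mem_image.1 he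
  have hi := mem_range.1 hi
  have h1 : 2 * b i ∈ Z := by
    have h2 := add_mem (hb' i hi) (hb' i hi)
    rcases neg_one_pow_eq_or ℝ i with h | h <;> rw [h] at h2
    · convert add_mem h2 h20 using 1
      ring
    · convert sub_mem h2 h20 using 1
      ring
  rw [← hZ, ← hsgnZ _ (C.edge_mem hi)]
  convert h1 using 1
  simp only [b]
  ring

theorem mem_closure_of_integral {G : SignedGraph V} (hG : G.Proper) (n : ℕ) (z : V → ℤ)
    (a : Sym2 V → ℝ) (ha : ∀ e, 0 ≤ a e)
    (hz : ∀ v, (z v : ℝ) = ∑ e ∈ G.edges, a e * (G.rho e v : ℝ))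
    (F : Finset (Sym2 V)) (hF : ∀ e, e ∈ F ↔ e ∈ G.edges ∧ ¬ ∃ n : ℤ, (n : ℝ) = a e)
    (hn : F.card = n) : z ∈ G.edgeMonoid ⊔ AddSubmonoid.closure G.oddCycleVecs := by
  classical
  induction n using Nat.strong_induction_on generalizing z a F with
  | _ n ih =>
    have step : ∀ (z' : V → ℤ) (a' : Sym2 V → ℝ), (∀ e, 0 ≤ a' e) →
        (∀ v, (z' v : ℝ) = ∑ e ∈ G.edges, a' e * (G.rho e v : ℝ)) →
        (∀ e ∉ F, a' e = a e) → (∃ e ∈ F, ∃ n : ℤ, (n : ℝ) = a' e) →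
        z' ∈ G.edgeMonoid ⊔ AddSubmonoid.closure G.oddCycleVecs := by
      intro z' a' ha' hz' heq ⟨e₀, he₀, hintegral⟩
      refine ih (G.edges.filter fun e => ¬ ∃ n : ℤ, (n : ℝ) = a' e).card ?_ z' a' ha' hz' _
        (fun e => mem_filter) rfl
      rw [← hn]
      refine card_lt_card ⟨fun e he => ?_, fun h => (mem_filter.1 (h he₀)).2 hintegral⟩
      obtain ⟨h1, h2⟩ := mem_filter.1 he
      by_contra h3
      rw [heq e h3] at h2
      exact h3 ((hF e).2 ⟨h1, h2⟩)
    rcases F.eq_empty_or_nonempty with rfl | hne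
    · refine AddSubmonoid.mem_sup_left ?_
      have h1 : ∀ e ∈ G.edges, ∃ n : ℕ, (n : ℝ) = a e := by
        intro e he
        obtain ⟨m, hm⟩ : ∃ n : ℤ, (n : ℝ) = a e := by
          by_contra hcon
          exact absurd ((hF e).2 ⟨he, hcon⟩) (notMem_empty e)
        have h2 : 0 ≤ m := by
          have := ha e
          rw [← hm] at this
          exact_mod_cast this
        lift m to ℕ using h2
        exact ⟨m, by simpa using hm⟩
      choose! c hc using h1
      have h3 : z = ∑ e ∈ G.edges, c e • G.rho e := by
        ext v
        have h4 : (z v : ℝ) = ((∑ e ∈ G.edges, (c e : ℤ) * G.rho e v : ℤ) : ℝ) := by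
          rw [hz v]
          push_cast
          exact sum_congr rfl fun e he => by rw [hc e he]
        rw [Finset.sum_apply, Int.cast_injective h4]
        simp
      rw [h3]
      exact sum_mem fun e he => nsmul_mem (rho_mem_edgeMonoid he) _
    by_cases hind : ∀ lam : Sym2 V → ℝ, (∀ v, ∑ e ∈ F, lam e * (G.rho e v : ℝ) = 0) →
      ∀ e ∈ F, lam e = 0
    · obtain ⟨l, C, hC, hodd, hsub, hhalf⟩ := exists_odd_cycle hG hz hF hne hind
      have hhalf' : ∀ e ∈ C.edgeFinset, ∃ n : ℕ, (n : ℝ) = a e - 1 / 2 := by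
        intro e he
        obtain ⟨m, hm⟩ := hhalf e he
        have h0 : 0 ≤ m := by
          have := ha e
          have : (0 : ℝ) ≤ m := by linarith
          exact_mod_cast this
        obtain ⟨k, rfl⟩ | ⟨k, rfl⟩ := Int.even_or_odd m
        · push_cast at hm
          exact absurd ⟨k, by linarith⟩ ((hF e).1 (hsub he)).2
        · have : 0 ≤ k := by omega
          lift k to ℕ using this
          push_cast at hm
          exact ⟨k, by linarith⟩
      have h1 : z - C.cycVec ∈ G.edgeMonoid ⊔ AddSubmonoid.closure G.oddCycleVecs := by
        refine step _ (fun e => a e - if e ∈ C.edgeFinset then 1 / 2 else 0) (fun e => ?_)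
          (fun v => ?_) (fun e he => ?_) ?_
        · split_ifs with he
          · obtain ⟨n, hn⟩ := hhalf' e he
            rw [← hn]
            positivity
          · simpa using ha e
        · have h2 : (2 * C.cycVec v : ℝ) = ∑ e ∈ C.edgeFinset, (G.rho e v : ℝ) := by
            rw [hC.sum_edgeFinset]
            exact_mod_cast Walk.two_mul_cycVec hG hC v
          simp_rw [sub_mul, sum_sub_distrib, ite_mul, zero_mul, sum_ite_mem,
            inter_eq_right.2 C.edgeFinset_subset, ← mul_sum, ← h2, ← hz]
          simp
        · rw [if_neg (fun h => he (hsub h)), sub_zero]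
        · have h0 : C.edge 0 ∈ C.edgeFinset := mem_image_of_mem _ (mem_range.2 hC.2.1)
          obtain ⟨n, hn⟩ := hhalf' _ h0
          refine ⟨C.edge 0, hsub h0, n, ?_⟩
          rw [if_pos h0, ← hn]
          simp
      rw [← sub_add_cancel z C.cycVec]
      exact add_mem h1 (AddSubmonoid.mem_sup_right
        (AddSubmonoid.subset_closure ⟨l, C, hC, hodd, rfl⟩))
    · push Not at hind
      obtain ⟨lam, hlam, hne⟩ := hind
      obtain ⟨b, hb0, hbF, hbint, hbsum⟩ :=
        exists_shift (fun e he => ((hF e).1 he).1) ha hlam hne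
      exact step z b hb0 (fun v => by rw [hbsum, hz]) hbF hbint

theorem mem_edgeLattice_iff {G : SignedGraph V} {z : V → ℤ} :
    z ∈ G.edgeLattice ↔ ∃ c : Sym2 V → ℤ, z = ∑ e ∈ G.edges, c e • G.rho e := by
  constructor
  · intro hz
    induction hz using AddSubgroup.closure_induction with
    | mem x hx =>
      obtain ⟨e, he, rfl⟩ := hx
      exact ⟨Pi.single e 1, by simp [Pi.single_apply, ite_smul, mem_coe.1 he]⟩
    | zero => exact ⟨0, by simp⟩
    | add x y _ _ hx hy =>
      obtain ⟨c, rfl⟩ := hx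
      obtain ⟨d, rfl⟩ := hy
      exact ⟨c + d, by simp [add_smul, sum_add_distrib]⟩
    | neg x _ hx =>
      obtain ⟨c, rfl⟩ := hx
      exact ⟨-c, by simp⟩
  · rintro ⟨c, rfl⟩
    exact sum_mem fun e he => zsmul_mem (rho_mem_edgeLattice he) _

/-- The integral points of the real cone spanned by the edge vectors. -/
def coneMonoid (G : SignedGraph V) : AddSubmonoid (V → ℤ) where
  carrier := {z | ∃ a : Sym2 V → ℝ, (∀ e, 0 ≤ a e) ∧
    ∀ v : V, ((z v : ℤ) : ℝ) = ∑ e ∈ G.edges, a e * ((G.rho e v : ℤ) : ℝ)}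
  zero_mem' := ⟨0, by simp, by simp⟩
  add_mem' := by
    rintro x y ⟨a, ha, hx⟩ ⟨b, hb, hy⟩
    exact ⟨a + b, fun e => add_nonneg (ha e) (hb e), fun v => by
      simp [hx, hy, add_mul, sum_add_distrib]⟩

theorem rho_mem_coneMonoid {G : SignedGraph V} {e : Sym2 V} (he : e ∈ G.edges) :
    G.rho e ∈ G.coneMonoid := by
  refine ⟨Pi.single e 1, fun e' => ?_, fun v => ?_⟩
  · rw [Pi.single_apply]
    split_ifs <;> norm_num
  · simp [Pi.single_apply, he]

theorem cycVec_mem_coneMonoid {G : SignedGraph V} (hG : G.Proper) {l : ℕ} {C : G.Walk l}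
    (hC : C.IsCycle) : C.cycVec ∈ G.coneMonoid := by
  have h : ∑ i ∈ range l, G.rho (C.edge i) ∈ G.coneMonoid :=
    sum_mem fun i hi => rho_mem_coneMonoid (C.edge_mem (mem_range.1 hi))
  obtain ⟨a, ha, hsum⟩ := h
  refine ⟨fun e => a e / 2, fun e => by have := ha e; positivity, fun v => ?_⟩
  have h2 := hsum v
  rw [Finset.sum_apply, ← Walk.two_mul_cycVec hG hC] at h2
  simp_rw [div_mul_eq_mul_div, ← sum_div, ← h2]
  simp

theorem exceptionalMonoid_eq {G : SignedGraph V} (hG : G.Proper) :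
    G.exceptionalMonoid = G.edgeLattice.toAddSubmonoid ⊓ G.coneMonoid := by
  apply le_antisymm
  · refine AddSubmonoid.closure_le.2 ?_
    rintro _ (⟨e, he, rfl⟩ | ⟨l₁, l₂, C, C', hC, hC', h₁, h₂, -, hcomp, -, rfl⟩)
    · exact ⟨rho_mem_edgeLattice he, rho_mem_coneMonoid he⟩
    · exact ⟨cycVec_add_cycVec_mem_edgeLattice hG hC hC' h₁ h₂ hcomp,
        add_mem (cycVec_mem_coneMonoid hG hC) (cycVec_mem_coneMonoid hG hC')⟩
  · rintro z ⟨hlat, a, ha, hz⟩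
    classical
    obtain ⟨x, hx, y, hy, rfl⟩ := AddSubmonoid.mem_sup.1 (mem_closure_of_integral hG _ z a ha hz
      (G.edges.filter fun e => ¬ ∃ n : ℤ, (n : ℝ) = a e) (fun e => mem_filter) rfl)
    obtain ⟨L, hL, rfl⟩ := AddSubmonoid.exists_list_of_mem_closure hy
    refine add_mem (G.edgeMonoid_le_exceptionalMonoid hx)
      (sum_mem_exceptionalMonoid hG _ L rfl hL ?_)
    exact (AddSubgroup.add_mem_cancel_left _ (G.edgeMonoid_le hx)).1 hlat

end SignedGraph

/-- the normalization of `k[G]` (the Ehrhart ring, i.e. the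
semigroup `T₁ = ℝ₊ρ(E) ∩ ℤρ(E)`) is generated over `k[G]` by the monomials of
the exceptional pairs of odd cycles; at the level of exponent semigroups, `T₁`
is the submonoid generated by the edge vectors together with the vectors of
the exceptional pairs. -/
theorem statement12 {V : Type} [DecidableEq V] (G : SignedGraph V) (hsgn : G.Proper) :
    (AddSubmonoid.closure
        ((fun e => G.rho e) '' ↑G.edges ∪
          {μ : V → ℤ | ∃ (l₁ l₂ : ℕ) (C : G.Walk l₁) (C' : G.Walk l₂),
            C.IsCycle ∧ C'.IsCycle ∧ Odd l₁ ∧ Odd l₂ ∧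
            SignedGraph.DisjointCycles C C' ∧
            G.SameComponent (C.vert 0) (C'.vert 0) ∧
            ¬SignedGraph.AltPathBetween G C C' ∧
            μ = C.cycVec + C'.cycVec}) : Set (V → ℤ)) =
      {z : V → ℤ |
        (∃ c : Sym2 V → ℤ, z = ∑ e ∈ G.edges, c e • G.rho e) ∧
        ∃ a : Sym2 V → ℝ, (∀ e, 0 ≤ a e) ∧
          ∀ v : V, ((z v : ℤ) : ℝ) = ∑ e ∈ G.edges, a e * ((G.rho e v : ℤ) : ℝ)} := by
  have h := SignedGraph.exceptionalMonoid_eq hsgn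
  ext z
  refine (SetLike.ext_iff.1 h z).trans ?_
  exact and_congr_left fun _ => SignedGraph.mem_edgeLattice_iff
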